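/- (Theorem 1, optimal assignment for the tree-based attack.) Let n ≥ 1, let b : Fin n → ℝ, let u > 0 and M > 0 be reals, and let c : Fin n → ℝ be nonnegative and nonincreasing (c 0 ≥ c 1 ≥ … ≥ c (n−1) ≥ 0). For each assignment a : Fin n → ℝ with 0 ≤ a i ≤ M for all i, let δ(a) be the unique Norm-Sub threshold of the vector i ↦ b i + u · a i, and define the objective Φ(a) = ∑_{i} c i · max(b i + u · a i − δ(a), 0). Then there exist an assignment a* in the cube {a | ∀ i, 0 ≤ a i ≤ M} and an index k : Fin n such that a* maximizes Φ over the cube and a* has the prefix-saturated form: a* i = M for all i < k, a* i = 0 for all i > k, and 0 ≤ a* k ≤ M. -/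

import Mathlib

/-- Norm-Sub thresholds are monotone, with slack `ε`. -/
theorem normSub_threshold_le {ι : Type*} [Fintype ι] {f g : ι → ℝ} {x y ε : ℝ}
    (hfg : ∀ i, f i ≤ g i + ε)
    (hx : ∑ i, max (f i - x) 0 = 1) (hy : ∑ i, max (g i - y) 0 = 1) : x ≤ y + ε := by
  by_contra! h
  obtain ⟨i, hi, hpos⟩ : ∃ i ∈ Finset.univ, 0 < max (f i - x) 0 :=
    Finset.exists_lt_of_sum_lt (by simp [hx])
  have hi_pos : 0 < f i - x := by simpa using hpos
  have hlt : ∑ i, max (f i - x) 0 < ∑ i, max (g i - y) 0 := by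
    refine Finset.sum_lt_sum (fun j _ => max_le_max (by linarith [hfg j]) le_rfl) ⟨i, hi, ?_⟩
    rw [max_eq_left hi_pos.le]
    exact lt_max_of_lt_left (by linarith [hfg i])
  linarith

/-- The Norm-Sub threshold depends continuously on the assignment. -/
theorem continuousOn_normSub_threshold {ι : Type*} [Fintype ι] {b : ι → ℝ} {u : ℝ} (hu : 0 ≤ u)
    {s : Set (ι → ℝ)} {δ : (ι → ℝ) → ℝ}
    (hδ : ∀ a ∈ s, ∑ i, max (b i + u * a i - δ a) 0 = 1) : ContinuousOn δ s := by
  have key : ∀ x ∈ s, ∀ y ∈ s, δ x ≤ δ y + u * dist x y := fun x hx y hy => by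
    refine normSub_threshold_le (f := fun i => b i + u * x i) (g := fun i => b i + u * y i)
      (fun i => ?_) (hδ x hx) (hδ y hy)
    have h := (le_abs_self _).trans ((Real.dist_eq (x i) (y i)).symm.le.trans
      (dist_le_pi_dist x y i))
    nlinarith [mul_le_mul_of_nonneg_left h hu]
  refine (LipschitzOnWith.of_dist_le_mul (K := ⟨u, hu⟩) fun x hx y hy => ?_).continuousOn
  have h₁ := key x hx y hy
  have h₂ := key y hy x hx
  rw [dist_comm y x] at h₂
  change |δ x - δ y| ≤ u * dist x y
  exact abs_le.2 ⟨by linarith, by linarith⟩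

/-- Moving mass towards indices before `k` does not decrease a sum with antitone weights. -/
theorem sum_mul_le_sum_mul_of_prefix {ι : Type*} [Fintype ι] [LinearOrder ι] {c p q : ι → ℝ}
    (hc : Antitone c) (k : ι) (hsum : ∑ i, p i = ∑ i, q i)
    (hlt : ∀ i < k, p i ≤ q i) (hgt : ∀ i, k < i → q i ≤ p i) :
    ∑ i, c i * p i ≤ ∑ i, c i * q i := by
  have h : 0 ≤ ∑ i, (c i - c k) * (q i - p i) := by
    refine Finset.sum_nonneg fun i _ => ?_
    rcases lt_trichotomy i k with hi | rfl | hi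
    · exact mul_nonneg (sub_nonneg.2 (hc hi.le)) (sub_nonneg.2 (hlt i hi))
    · simp
    · exact mul_nonneg_of_nonpos_of_nonpos (sub_nonpos.2 (hc hi.le)) (sub_nonpos.2 (hgt i hi))
  have h' : ∑ i, (c i - c k) * (q i - p i)
      = ∑ i, c i * q i - ∑ i, c i * p i - c k * (∑ i, q i - ∑ i, p i) := by
    simp only [mul_sub, Finset.mul_sum, ← Finset.sum_sub_distrib]
    exact Finset.sum_congr rfl fun i _ => by ring
  rw [h', hsum] at h
  linarith

/-- The assignment that spends a budget `t` on the indices in increasing order, at most `M` each. -/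
def prefixFill (n : ℕ) (M t : ℝ) (i : Fin n) : ℝ := max 0 (min M (t - i * M))

theorem prefixFill_mem {n : ℕ} {M : ℝ} (hM : 0 ≤ M) (t : ℝ) (i : Fin n) :
    0 ≤ prefixFill n M t i ∧ prefixFill n M t i ≤ M :=
  ⟨le_max_left _ _, max_le hM (min_le_left _ _)⟩

theorem prefixFill_eq_of_le {n : ℕ} {M t : ℝ} (hM : 0 ≤ M) {i : Fin n}
    (h : ((i : ℝ) + 1) * M ≤ t) : prefixFill n M t i = M := by
  rw [prefixFill, min_eq_left (by linarith), max_eq_right hM]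

theorem prefixFill_eq_zero {n : ℕ} {M t : ℝ} {i : Fin n}
    (h : t ≤ i * M) : prefixFill n M t i = 0 :=
  max_eq_left ((min_le_right _ _).trans (by linarith))

theorem exists_prefixFill_saturated {n : ℕ} (hn : 1 ≤ n) {M t : ℝ} (hM : 0 < M) (ht : 0 ≤ t) :
    ∃ k : Fin n, (∀ i < k, prefixFill n M t i = M) ∧ ∀ i, k < i → prefixFill n M t i = 0 := by
  have hfloor : (⌊t / M⌋₊ : ℝ) * M ≤ t := (le_div_iff₀ hM).1 (Nat.floor_le (by positivity))
  have hfloor' : t < ((⌊t / M⌋₊ : ℝ) + 1) * M := (div_lt_iff₀ hM).1 (Nat.lt_floor_add_one _)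
  refine ⟨⟨min ⌊t / M⌋₊ (n - 1), by omega⟩, fun i hi => ?_, fun i hi => ?_⟩
  · have h : (i : ℕ) + 1 ≤ ⌊t / M⌋₊ := by
      have : (i : ℕ) < min ⌊t / M⌋₊ (n - 1) := hi
      omega
    have h' : (i : ℝ) + 1 ≤ ⌊t / M⌋₊ := by exact_mod_cast h
    exact prefixFill_eq_of_le hM.le (by nlinarith)
  · have h : ⌊t / M⌋₊ + 1 ≤ (i : ℕ) := by
      have : min ⌊t / M⌋₊ (n - 1) < (i : ℕ) := hi
      omega
    have h' : (⌊t / M⌋₊ : ℝ) + 1 ≤ i := by exact_mod_cast h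
    exact prefixFill_eq_zero (by nlinarith)

/-- At a fixed threshold, the Norm-Sub mass of any assignment in the cube is attained by a
prefix filling. -/
theorem exists_prefixFill_sum_eq {n : ℕ} {b : Fin n → ℝ} {u M : ℝ} (hu : 0 ≤ u) (hM : 0 ≤ M)
    (d : ℝ) {a : Fin n → ℝ} (ha : ∀ i, 0 ≤ a i ∧ a i ≤ M) :
    ∃ t, 0 ≤ t ∧ ∑ i, max (b i + u * prefixFill n M t i - d) 0 =
      ∑ i, max (b i + u * a i - d) 0 := by
  have hcont : Continuous fun t => ∑ i, max (b i + u * prefixFill n M t i - d) 0 := by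
    unfold prefixFill
    fun_prop
  have hnM : 0 ≤ n * M := by positivity
  suffices h : ∑ i, max (b i + u * a i - d) 0 ∈ Set.Icc
      (∑ i, max (b i + u * prefixFill n M 0 i - d) 0)
      (∑ i, max (b i + u * prefixFill n M (n * M) i - d) 0) by
    obtain ⟨t, ht, h⟩ := intermediate_value_Icc hnM hcont.continuousOn h
    exact ⟨t, ht.1, h⟩
  constructor
  · refine Finset.sum_le_sum fun i _ => max_le_max ?_ le_rfl
    rw [prefixFill_eq_zero (by positivity)]
    linarith [mul_nonneg hu (ha i).1]
  · refine Finset.sum_le_sum fun i _ => max_le_max ?_ le_rfl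
    have hi : (i : ℝ) + 1 ≤ n := by exact_mod_cast i.isLt
    rw [prefixFill_eq_of_le hM (mul_le_mul_of_nonneg_right hi hM)]
    linarith [mul_le_mul_of_nonneg_left (ha i).2 hu]

/-- **Theorem 1 (optimal assignment for the tree-based attack).**
Let `c` be nonnegative and nonincreasing.  For each assignment `a` in the cube
`{a | ∀ i, 0 ≤ a i ≤ M}`, let `δ a` be the (unique) Norm-Sub threshold of the
vector `i ↦ b i + u * a i`, and let `Φ a = ∑ i, c i * max (b i + u * a i - δ a) 0`.
Then there is a maximizer `astar` of `Φ` over the cube having the prefix-saturated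
form: for some index `k`, `astar i = M` for `i < k`, `astar i = 0` for `i > k`,
and `0 ≤ astar k ≤ M`. -/
theorem tree_attack_optimal_assignment (n : ℕ) (hn : 1 ≤ n)
    (b : Fin n → ℝ) (u M : ℝ) (hu : 0 < u) (hM : 0 < M)
    (c : Fin n → ℝ) (hc_nonneg : ∀ i, 0 ≤ c i)
    (hc_mono : ∀ i j : Fin n, i ≤ j → c j ≤ c i)
    (δ : (Fin n → ℝ) → ℝ)
    (hδ : ∀ a : Fin n → ℝ, (∀ i, 0 ≤ a i ∧ a i ≤ M) →
      ∑ i : Fin n, max (b i + u * a i - δ a) 0 = 1) :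
    ∃ (astar : Fin n → ℝ) (k : Fin n),
      (∀ i, 0 ≤ astar i ∧ astar i ≤ M) ∧
      (∀ a : Fin n → ℝ, (∀ i, 0 ≤ a i ∧ a i ≤ M) →
        ∑ i : Fin n, c i * max (b i + u * a i - δ a) 0 ≤
          ∑ i : Fin n, c i * max (b i + u * astar i - δ astar) 0) ∧
      (∀ i : Fin n, i < k → astar i = M) ∧
      (∀ i : Fin n, k < i → astar i = 0) ∧
      0 ≤ astar k ∧ astar k ≤ M := by
  let cube : Set (Fin n → ℝ) := {a | ∀ i, 0 ≤ a i ∧ a i ≤ M}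
  have hcube : cube = Set.Icc 0 (fun _ => M) := by
    ext a
    simp [cube, Pi.le_def, forall_and]
  have hcompact : IsCompact cube := hcube ▸ isCompact_Icc
  have hδ_cont : ContinuousOn δ cube := continuousOn_normSub_threshold hu.le hδ
  have hΦ_cont : ContinuousOn (fun a => ∑ i, c i * max (b i + u * a i - δ a) 0) cube := by
    fun_prop
  obtain ⟨a, ha, hmax⟩ := hcompact.exists_isMaxOn ⟨0, fun _ => ⟨le_rfl, hM.le⟩⟩ hΦ_cont
  obtain ⟨t, ht, hsum⟩ := exists_prefixFill_sum_eq (b := b) hu.le hM.le (δ a) ha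
  obtain ⟨k, hlt, hgt⟩ := exists_prefixFill_saturated hn hM ht
  have hmem : ∀ i, 0 ≤ prefixFill n M t i ∧ prefixFill n M t i ≤ M := prefixFill_mem hM.le t
  have hδ_eq : δ (prefixFill n M t) = δ a := by
    have h₁ := hδ _ hmem
    have h₂ := hsum.trans (hδ a ha)
    refine le_antisymm ?_ ?_
    · simpa using normSub_threshold_le (ε := 0) (fun i => by simp) h₁ h₂
    · simpa using normSub_threshold_le (ε := 0) (fun i => by simp) h₂ h₁
  refine ⟨prefixFill n M t, k, hmem, fun a' ha' => (hmax ha').trans ?_, hlt, hgt, hmem k⟩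
  rw [hδ_eq]
  refine sum_mul_le_sum_mul_of_prefix (fun i j => hc_mono i j) k hsum.symm
    (fun i hi => max_le_max ?_ le_rfl) (fun i hi => max_le_max ?_ le_rfl)
  · rw [hlt i hi]
    linarith [mul_le_mul_of_nonneg_left (ha i).2 hu.le]
  · rw [hgt i hi]
    linarith [mul_nonneg hu.le (ha i).1]
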